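/- The Bogomolny decomposition of the energy density holds pointwise with either choice of sign: for any pair (A,Φ), e(A,Φ) = ½ Σ_{i<j} ⟨Fᵢⱼ ∓ (*∇Φ)ᵢⱼ, Fᵢⱼ ∓ (*∇Φ)ᵢⱼ⟩ ± (∂₁⟨F₂₃,Φ⟩ + ∂₂⟨F₃₁,Φ⟩ + ∂₃⟨F₁₂,Φ⟩) at every point of ℝ³, where (*∇Φ)₂₃ = ∇₁Φ, (*∇Φ)₃₁ = ∇₂Φ, (*∇Φ)₁₂ = ∇₃Φ. -/

import Mathlib

open Matrix

attribute [local instance] Matrix.normedAddCommGroup Matrix.normedSpace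

abbrev M2 := Matrix (Fin 2) (Fin 2) ℂ

/-- Partial derivative in the `i`-th coordinate direction on `ℝ³`. -/
noncomputable def pd {E : Type*} [NormedAddCommGroup E] [NormedSpace ℝ E]
    (i : Fin 3) (f : (Fin 3 → ℝ) → E) (x : Fin 3 → ℝ) : E :=
  fderiv ℝ f x (Pi.single i 1)

/-- Membership in su(2): traceless and skew-Hermitian. -/
def isSu2 (X : M2) : Prop := X.trace = 0 ∧ Xᴴ = -X

/-- Membership in SU(2): unitary with determinant 1. -/
def isSU2 (g : M2) : Prop := gᴴ * g = 1 ∧ g.det = 1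

/-- Curvature components `F_{ij} = ∂ᵢAⱼ - ∂ⱼAᵢ + [Aᵢ, Aⱼ]`. -/
noncomputable def curv (A : Fin 3 → (Fin 3 → ℝ) → M2) (i j : Fin 3) (x : Fin 3 → ℝ) : M2 :=
  pd i (A j) x - pd j (A i) x + (A i x * A j x - A j x * A i x)

/-- Covariant derivative `∇ᵢX = ∂ᵢX + [Aᵢ, X]`. -/
noncomputable def covD (A : Fin 3 → (Fin 3 → ℝ) → M2) (i : Fin 3)
    (X : (Fin 3 → ℝ) → M2) (x : Fin 3 → ℝ) : M2 :=
  pd i X x + (A i x * X x - X x * A i x)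

/-- The gauge-transformed connection `A^g_i = g Aᵢ g⁻¹ + g ∂ᵢ(g⁻¹)`. -/
noncomputable def gaugeA (g : (Fin 3 → ℝ) → M2) (A : Fin 3 → (Fin 3 → ℝ) → M2)
    (i : Fin 3) (x : Fin 3 → ℝ) : M2 :=
  g x * A i x * (g x)⁻¹ + g x * pd i (fun y => (g y)⁻¹) x

/-- The invariant inner product `⟨X, Y⟩ = -tr(XY)` on su(2) (real-valued there). -/
noncomputable def ip (X Y : M2) : ℝ := (-(X * Y).trace).re

/-- The energy density `e(A,Φ) = ½ Σ_{i<j} ⟨F_{ij},F_{ij}⟩ + ½ Σᵢ ⟨∇ᵢΦ,∇ᵢΦ⟩`. -/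
noncomputable def energyDensity (A : Fin 3 → (Fin 3 → ℝ) → M2)
    (Φ : (Fin 3 → ℝ) → M2) (x : Fin 3 → ℝ) : ℝ :=
  (1 / 2) * (ip (curv A 0 1 x) (curv A 0 1 x) + ip (curv A 0 2 x) (curv A 0 2 x)
      + ip (curv A 1 2 x) (curv A 1 2 x))
    + (1 / 2) * ∑ i : Fin 3, ip (covD A i Φ x) (covD A i Φ x)

/-- The divergence term `∂₁⟨F₂₃,Φ⟩ + ∂₂⟨F₃₁,Φ⟩ + ∂₃⟨F₁₂,Φ⟩`. -/
noncomputable def divTerm (A : Fin 3 → (Fin 3 → ℝ) → M2)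
    (Φ : (Fin 3 → ℝ) → M2) (x : Fin 3 → ℝ) : ℝ :=
  pd 0 (fun y => ip (curv A 1 2 y) (Φ y)) x
    + pd 1 (fun y => ip (curv A 2 0 y) (Φ y)) x
    + pd 2 (fun y => ip (curv A 0 1 y) (Φ y)) x

open scoped ContDiff

/-- The Leibniz rule for partial derivatives, for an arbitrary bilinear map between
finite-dimensional spaces. -/
theorem pd_bilin {E F G : Type*} [NormedAddCommGroup E] [NormedSpace ℝ E] [FiniteDimensional ℝ E]
    [NormedAddCommGroup F] [NormedSpace ℝ F] [FiniteDimensional ℝ F]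
    [NormedAddCommGroup G] [NormedSpace ℝ G] (B : E →ₗ[ℝ] F →ₗ[ℝ] G)
    {f : (Fin 3 → ℝ) → E} {g : (Fin 3 → ℝ) → F} {x : Fin 3 → ℝ}
    (hf : DifferentiableAt ℝ f x) (hg : DifferentiableAt ℝ g x) (i : Fin 3) :
    pd i (fun y => B (f y) (g y)) x = B (pd i f x) (g x) + B (f x) (pd i g x) := by
  let C : E →L[ℝ] F →L[ℝ] G :=
    ((LinearMap.toContinuousLinearMap (𝕜 := ℝ) (E := F) (F' := G)).toLinearMap ∘ₗ B).toContinuousLinearMap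
  have h := C.hasFDerivAt_of_bilinear hf.hasFDerivAt hg.hasFDerivAt
  have h' : fderiv ℝ (fun y => B (f y) (g y)) x = _ := h.fderiv
  simp only [pd, h']
  simp [C, add_comm]

theorem pd_add {E : Type*} [NormedAddCommGroup E] [NormedSpace ℝ E]
    {f g : (Fin 3 → ℝ) → E} {x : Fin 3 → ℝ}
    (hf : DifferentiableAt ℝ f x) (hg : DifferentiableAt ℝ g x) (i : Fin 3) :
    pd i (fun y => f y + g y) x = pd i f x + pd i g x := by
  simp [pd, fderiv_fun_add hf hg]

theorem pd_sub {E : Type*} [NormedAddCommGroup E] [NormedSpace ℝ E]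
    {f g : (Fin 3 → ℝ) → E} {x : Fin 3 → ℝ}
    (hf : DifferentiableAt ℝ f x) (hg : DifferentiableAt ℝ g x) (i : Fin 3) :
    pd i (fun y => f y - g y) x = pd i f x - pd i g x := by
  simp [pd, fderiv_fun_sub hf hg]

theorem ContDiff.partialDeriv {E : Type*} [NormedAddCommGroup E] [NormedSpace ℝ E]
    {f : (Fin 3 → ℝ) → E} (hf : ContDiff ℝ ∞ f) (i : Fin 3) : ContDiff ℝ ∞ (pd i f) :=
  (hf.fderiv_right (m := ∞) (by simp)).clm_apply contDiff_const

/-- Partial derivatives of smooth maps commute. -/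
theorem pd_comm {E : Type*} [NormedAddCommGroup E] [NormedSpace ℝ E]
    {f : (Fin 3 → ℝ) → E} (hf : ContDiff ℝ ∞ f) (i j : Fin 3) (x : Fin 3 → ℝ) :
    pd i (pd j f) x = pd j (pd i f) x := by
  have hd : DifferentiableAt ℝ (fderiv ℝ f) x :=
    (hf.fderiv_right (m := ∞) (by simp)).differentiable (by simp) x
  have key : ∀ k l : Fin 3, pd k (pd l f) x
      = fderiv ℝ (fderiv ℝ f) x (Pi.single k 1) (Pi.single l 1) := by
    intro k l
    have h := (hd.hasFDerivAt.clm_apply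
      (hasFDerivAt_const (Pi.single l (1 : ℝ) : Fin 3 → ℝ) x)).fderiv
    have h' : fderiv ℝ (pd l f) x = _ := h
    rw [pd, h']
    simp
  rw [key, key]
  exact (hf.contDiffAt.isSymmSndFDerivAt (by simpa using ENat.LEInfty.out)).eq _ _

/-- The inner product `ip` as a real bilinear form. -/
noncomputable def ipBilin : M2 →ₗ[ℝ] M2 →ₗ[ℝ] ℝ :=
  LinearMap.mk₂ ℝ ip
    (by intros; simp [ip, add_mul]; ring)
    (by intros; simp [ip])
    (by intros; simp [ip, mul_add]; ring)
    (by intros; simp [ip])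

theorem ipBilin_apply (X Y : M2) : ipBilin X Y = ip X Y := rfl

theorem ip_comm (X Y : M2) : ip X Y = ip Y X := by
  rw [ip, ip, Matrix.trace_mul_comm]

/-- Invariance of `ip` under the adjoint action. -/
theorem ip_commutator (Z X Y : M2) :
    ip (Z * X - X * Z) Y + ip X (Z * Y - Y * Z) = 0 := by
  have h : (Z * (X * Y)).trace = (X * (Y * Z)).trace := by
    rw [Matrix.trace_mul_comm, Matrix.mul_assoc]
  simp only [ip, sub_mul, mul_sub, Matrix.trace_sub, Matrix.mul_assoc, h]
  simp

theorem pd_mul {f g : (Fin 3 → ℝ) → M2} {x : Fin 3 → ℝ}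
    (hf : DifferentiableAt ℝ f x) (hg : DifferentiableAt ℝ g x) (i : Fin 3) :
    pd i (fun y => f y * g y) x = pd i f x * g x + f x * pd i g x :=
  pd_bilin (LinearMap.mul ℝ M2) hf hg i

theorem ContDiff.matrix_mul {f g : (Fin 3 → ℝ) → M2} (hf : ContDiff ℝ ∞ f)
    (hg : ContDiff ℝ ∞ g) : ContDiff ℝ ∞ (fun y => f y * g y) := by
  let C : M2 →L[ℝ] M2 →L[ℝ] M2 :=
    ((LinearMap.toContinuousLinearMap (𝕜 := ℝ) (E := M2) (F' := M2)).toLinearMap ∘ₗ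
      LinearMap.mul ℝ M2).toContinuousLinearMap
  exact C.isBoundedBilinearMap.contDiff.comp (hf.prodMk hg)

theorem contDiff_curv {A : Fin 3 → (Fin 3 → ℝ) → M2} (hA : ∀ i, ContDiff ℝ ∞ (A i))
    (i j : Fin 3) : ContDiff ℝ ∞ (curv A i j) :=
  (((hA j).partialDeriv i).sub ((hA i).partialDeriv j)).add
    (((hA i).matrix_mul (hA j)).sub ((hA j).matrix_mul (hA i)))

/-- The metric compatibility of the covariant derivative. -/
theorem pd_ip (A : Fin 3 → (Fin 3 → ℝ) → M2) {X Y : (Fin 3 → ℝ) → M2} {x : Fin 3 → ℝ}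
    (hX : DifferentiableAt ℝ X x) (hY : DifferentiableAt ℝ Y x) (i : Fin 3) :
    pd i (fun y => ip (X y) (Y y)) x = ip (covD A i X x) (Y x) + ip (X x) (covD A i Y x) := by
  have h : pd i (fun y => ip (X y) (Y y)) x = ip (pd i X x) (Y x) + ip (X x) (pd i Y x) :=
    pd_bilin ipBilin hX hY i
  have hc := ip_commutator (A i x) (X x) (Y x)
  rw [h, covD, covD]
  simp only [← ipBilin_apply, map_add, LinearMap.add_apply] at hc ⊢
  linarith

theorem pd_curv {A : Fin 3 → (Fin 3 → ℝ) → M2} (hA : ∀ i, ContDiff ℝ ∞ (A i))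
    (i j k : Fin 3) (x : Fin 3 → ℝ) :
    pd i (curv A j k) x = pd i (pd j (A k)) x - pd i (pd k (A j)) x
      + (pd i (A j) x * A k x + A j x * pd i (A k) x
        - (pd i (A k) x * A j x + A k x * pd i (A j) x)) := by
  have d : ∀ {f : (Fin 3 → ℝ) → M2}, ContDiff ℝ ∞ f → DifferentiableAt ℝ f x :=
    fun hf => hf.differentiable (by simp) x
  have hj := hA j
  have hk := hA k
  change pd i (fun y => (pd j (A k) y - pd k (A j) y) + (A j y * A k y - A k y * A j y)) x = _
  rw [pd_add (d ((hk.partialDeriv j).sub (hj.partialDeriv k))) (d ((hj.matrix_mul hk).sub (hk.matrix_mul hj))),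
    pd_sub (d (hk.partialDeriv j)) (d (hj.partialDeriv k)),
    pd_sub (d (hj.matrix_mul hk)) (d (hk.matrix_mul hj)),
    pd_mul (d hj) (d hk), pd_mul (d hk) (d hj)]

/-- The Bianchi identity. -/
theorem bianchi {A : Fin 3 → (Fin 3 → ℝ) → M2} (hA : ∀ i, ContDiff ℝ ∞ (A i))
    (i j k : Fin 3) (x : Fin 3 → ℝ) :
    covD A i (curv A j k) x + covD A j (curv A k i) x + covD A k (curv A i j) x = 0 := by
  simp only [covD, pd_curv hA, curv]
  rw [pd_comm (hA k) i j, pd_comm (hA j) i k, pd_comm (hA i) j k]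
  noncomm_ring

theorem curv_swap (A : Fin 3 → (Fin 3 → ℝ) → M2) (i j : Fin 3) (x : Fin 3 → ℝ) :
    curv A i j x = -curv A j i x := by
  simp only [curv]
  abel

/-- The divergence term is the pairing of the curvature with `*∇Φ`. -/
theorem divTerm_eq {A : Fin 3 → (Fin 3 → ℝ) → M2} (hA : ∀ i, ContDiff ℝ ∞ (A i))
    {Φ : (Fin 3 → ℝ) → M2} (hΦ : ContDiff ℝ ∞ Φ) (x : Fin 3 → ℝ) :
    divTerm A Φ x = ip (curv A 1 2 x) (covD A 0 Φ x) + ip (curv A 2 0 x) (covD A 1 Φ x)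
      + ip (curv A 0 1 x) (covD A 2 Φ x) := by
  have d : ∀ {f : (Fin 3 → ℝ) → M2}, ContDiff ℝ ∞ f → DifferentiableAt ℝ f x :=
    fun hf => hf.differentiable (by simp) x
  have hb := congrArg (fun X => ipBilin X (Φ x)) (bianchi hA 0 1 2 x)
  simp only [map_add, LinearMap.add_apply, map_zero, LinearMap.zero_apply, ipBilin_apply] at hb
  rw [divTerm, pd_ip A (d (contDiff_curv hA 1 2)) (d hΦ), pd_ip A (d (contDiff_curv hA 2 0)) (d hΦ),
    pd_ip A (d (contDiff_curv hA 0 1)) (d hΦ)]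
  linarith

theorem ip_add_self (X Y : M2) : ip (X + Y) (X + Y) = ip X X + 2 * ip X Y + ip Y Y := by
  have h := ip_comm X Y
  simp only [← ipBilin_apply, map_add, LinearMap.add_apply] at h ⊢
  linarith

theorem ip_sub_self (X Y : M2) : ip (X - Y) (X - Y) = ip X X - 2 * ip X Y + ip Y Y := by
  have h := ip_comm X Y
  simp only [← ipBilin_apply, map_sub, LinearMap.sub_apply] at h ⊢
  linarith

/-- The pointwise Bogomolny decomposition of the energy density, with either
choice of sign.  Here `(*∇Φ)₂₃ = ∇₁Φ`, `(*∇Φ)₃₁ = ∇₂Φ`, `(*∇Φ)₁₂ = ∇₃Φ`, and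
the sum over `i < j` is written over the unordered pairs `{2,3}, {3,1}, {1,2}`. -/
theorem bogomolny_energy_decomposition (A : Fin 3 → (Fin 3 → ℝ) → M2)
    (hA : ∀ i, ContDiff ℝ (⊤ : ℕ∞) (A i)) (hAsu : ∀ i x, isSu2 (A i x))
    (Φ : (Fin 3 → ℝ) → M2) (hΦ : ContDiff ℝ (⊤ : ℕ∞) Φ) (hΦsu : ∀ x, isSu2 (Φ x))
    (x : Fin 3 → ℝ) :
    (energyDensity A Φ x
      = (1 / 2) * (ip (curv A 1 2 x - covD A 0 Φ x) (curv A 1 2 x - covD A 0 Φ x)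
          + ip (curv A 2 0 x - covD A 1 Φ x) (curv A 2 0 x - covD A 1 Φ x)
          + ip (curv A 0 1 x - covD A 2 Φ x) (curv A 0 1 x - covD A 2 Φ x))
        + divTerm A Φ x)
    ∧ (energyDensity A Φ x
      = (1 / 2) * (ip (curv A 1 2 x + covD A 0 Φ x) (curv A 1 2 x + covD A 0 Φ x)
          + ip (curv A 2 0 x + covD A 1 Φ x) (curv A 2 0 x + covD A 1 Φ x)
          + ip (curv A 0 1 x + covD A 2 Φ x) (curv A 0 1 x + covD A 2 Φ x))
        - divTerm A Φ x) := by
  have hs : ip (curv A 0 2 x) (curv A 0 2 x) = ip (curv A 2 0 x) (curv A 2 0 x) := by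
    rw [curv_swap A 0 2]
    simp [ip]
  rw [energyDensity, Fin.sum_univ_three, divTerm_eq hA hΦ, hs]
  simp only [ip_add_self, ip_sub_self]
  constructor <;> ring
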